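/- Let Δ be a regular right angled building of type (W,S) with all panels finite, and suppose there is an index i ∈ B such that: (a) every i-panel has at least 3 chambers; and (b) there is no finite subset J ⊆ B with i ∈ J such that M j j' = 2 for all distinct j, j' ∈ J and M j k = 2 for all j ∈ J and all k ∉ J (i.e., sᵢ is not contained in a finite direct factor of W). Then the full (type preserving) automorphism group of Δ — the group of bijections G : Δ → Δ with δ (G C) (G D) = δ C D for all C, D — is uncountable. -/

import Mathlib

namespace RAB

open Classical in
/-- The affine action of a simple reflection on functions `W → ZMod 2`. -/
noncomputable def act {B W : Type*} [Group W] {M : CoxeterMatrix B} (cs : CoxeterSystem M W)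
    (j : B) : Function.End (W → ZMod 2) :=
  fun F t => (if t = cs.simple j then 1 else 0) + F (cs.simple j * t * cs.simple j)

section Cox
variable {B W : Type*} [Group W] {M : CoxeterMatrix B} (cs : CoxeterSystem M W)

lemma zmod2_add_self (a : ZMod 2) : a + a = 0 := CharTwo.add_self_eq_zero a

lemma comm_of_two {j k : B} (h : M j k = 2) :
    cs.simple j * cs.simple k = cs.simple k * cs.simple j := by
  have h1 := cs.simple_mul_simple_pow j k
  rw [h, pow_two] at h1
  have := mul_eq_one_iff_eq_inv.mp h1
  rw [this]
  simp

lemma act_act (j : B) (F : W → ZMod 2) : act cs j (act cs j F) = F := by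
  funext t
  simp only [act]
  have h1 : (cs.simple j * t * cs.simple j = cs.simple j) ↔ t = cs.simple j := by
    constructor
    · intro h
      have : cs.simple j * t = 1 := by simpa using h
      have := eq_inv_of_mul_eq_one_right this
      simpa using this
    · rintro rfl; simp
  have h2 : cs.simple j * (cs.simple j * t * cs.simple j) * cs.simple j = t := by
    simp [mul_assoc]
  rw [h2]
  classical
  simp only [h1]
  rw [← add_assoc, zmod2_add_self, zero_add]

lemma act_comm {j k : B} (h : M j k = 2) (F : W → ZMod 2) :
    act cs j (act cs k F) = act cs k (act cs j F) := by
  have hc := comm_of_two cs h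
  funext t
  simp only [act]
  have key : ∀ a b : W, a * a = 1 → b * b = 1 → a * b = b * a → (a * t * a = b ↔ t = b) := by
    intro a b ha hb hab
    constructor
    · intro h
      have : t = a * (a * t * a) * a := by
        calc t = (a * a) * t * (a * a) := by rw [ha]; simp
          _ = _ := by simp only [mul_assoc]
      rw [this, h, hab, mul_assoc, ha, mul_one]
    · rintro rfl
      rw [hab, mul_assoc, ha, mul_one]
  have e1 := key (cs.simple j) (cs.simple k) (by simp) (by simp) hc
  have e2 := key (cs.simple k) (cs.simple j) (by simp) (by simp) hc.symm
  have e3 : cs.simple k * (cs.simple j * t * cs.simple j) * cs.simple k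
      = cs.simple j * (cs.simple k * t * cs.simple k) * cs.simple j := by
    calc _ = (cs.simple k * cs.simple j) * t * (cs.simple j * cs.simple k) := by
          simp only [mul_assoc]
      _ = (cs.simple j * cs.simple k) * t * (cs.simple k * cs.simple j) := by rw [hc]
      _ = _ := by simp only [mul_assoc]
  rw [e3]
  classical
  simp only [e1, e2]
  ring

/-- right angled matrices -/
def RA (M : CoxeterMatrix B) : Prop := ∀ i j : B, i ≠ j → M i j = 2 ∨ M i j = 0

lemma act_liftable (hra : RA M) : M.IsLiftable (act cs) := by
  intro j k
  by_cases hjk : j = k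
  · subst hjk
    rw [M.diagonal, pow_one]
    funext F
    exact act_act cs j F
  · rcases hra j k hjk with h | h
    · rw [h, pow_two]
      funext F
      change act cs j (act cs k (act cs j (act cs k F))) = F
      rw [act_comm cs h, act_act, act_act]
    · rw [h, pow_zero]

/-- inversion parity -/
noncomputable def N (hra : RA M) (w : W) : W → ZMod 2 :=
  (cs.lift ⟨act cs, act_liftable cs hra⟩ w : Function.End (W → ZMod 2)) 0

variable (hra : RA M)

lemma N_one : N cs hra 1 = 0 := by
  unfold N
  rw [map_one]; rfl

lemma N_simple_mul (j : B) (w : W) : N cs hra (cs.simple j * w) = act cs j (N cs hra w) := by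
  unfold N
  rw [map_mul, CoxeterSystem.lift_apply_simple]; rfl

lemma N_mem_lis (ω : List B) (t : W) (h : N cs hra (cs.wordProd ω) t ≠ 0) :
    t ∈ cs.leftInvSeq ω := by
  induction ω generalizing t with
  | nil => simp [N_one] at h
  | cons j ω ih =>
    rw [cs.wordProd_cons, N_simple_mul] at h
    simp only [act] at h
    simp only [CoxeterSystem.leftInvSeq, List.mem_cons, List.mem_map]
    by_cases ht : t = cs.simple j
    · exact Or.inl ht
    · right
      rw [if_neg ht, zero_add] at h
      exact ⟨_, ih _ h, by simp [mul_assoc]⟩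

lemma N_lt {w t : W} (h : N cs hra w t ≠ 0) : cs.length (t * w) < cs.length w := by
  obtain ⟨ω, hω, rfl⟩ := cs.exists_isReduced w
  exact (cs.isLeftInversion_of_mem_leftInvSeq hω (N_mem_lis cs hra ω t h)).2

lemma N_simple_iff {w : W} {j : B} :
    N cs hra w (cs.simple j) ≠ 0 ↔ cs.IsLeftDescent w j := by
  constructor
  · exact N_lt cs hra
  · intro h h0
    have : N cs hra (cs.simple j * w) (cs.simple j) ≠ 0 := by
      rw [N_simple_mul]
      simp [act, h0]
    have := N_lt cs hra this
    simp only [CoxeterSystem.simple_mul_simple_cancel_left] at this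
    unfold CoxeterSystem.IsLeftDescent at h
    omega

/-- Every map to commuting-involution data lifts, version for `Multiplicative (ZMod 2)`. -/
lemma exists_hom (hra : RA M) (l : B) : ∃ f : W →* Multiplicative (ZMod 2),
    f (cs.simple l) ≠ 1 ∧ ∀ k, k ≠ l → f (cs.simple k) = 1 := by
  classical
  have hsq : ∀ a : Multiplicative (ZMod 2), a * a = 1 := by decide
  have hl : M.IsLiftable (fun k => if k = l then Multiplicative.ofAdd (1 : ZMod 2) else 1) := by
    intro j k
    by_cases hjk : j = k
    · subst hjk
      rw [M.diagonal, pow_one, hsq]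
    · rcases hra j k hjk with h | h
      · rw [h, pow_two, hsq]
      · rw [h, pow_zero]
  refine ⟨cs.lift ⟨_, hl⟩, ?_, ?_⟩
  · rw [CoxeterSystem.lift_apply_simple]
    simp
  · intro k hk
    rw [CoxeterSystem.lift_apply_simple]
    simp [hk]

lemma simple_inj (hra : RA M) {j k : B} (h : cs.simple j = cs.simple k) : j = k := by
  by_contra hne
  obtain ⟨f, h1, h2⟩ := exists_hom cs hra j
  exact h1 (h ▸ h2 k (Ne.symm hne))

lemma desc_comm (hra : RA M) {j k : B} (hne : j ≠ k) (h : M j k = 2) (w : W) :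
    cs.IsLeftDescent (cs.simple j * w) k ↔ cs.IsLeftDescent w k := by
  rw [← N_simple_iff cs hra, ← N_simple_iff cs hra, N_simple_mul]
  have h1 : cs.simple k ≠ cs.simple j := fun h => hne (simple_inj cs hra h).symm
  have h2 : cs.simple j * cs.simple k * cs.simple j = cs.simple k := by
    rw [comm_of_two cs h]; simp
  simp only [act, if_neg h1, zero_add, h2]

/-- alternating products -/
def alt (j k : B) : ℕ → W
  | 0 => 1
  | m + 1 => cs.simple j * alt k j m

lemma alt_two (j k : B) (m : ℕ) :
    alt cs j k (m + 2) = cs.simple j * (cs.simple k * alt cs j k m) := rfl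

lemma alt_odd_mul (j k : B) (n : ℕ) :
    alt cs j k (2 * n + 1) * cs.simple k = alt cs j k (2 * n + 2) := by
  induction n with
  | zero => simp [alt]
  | succ n ih =>
    rw [show 2 * (n + 1) + 1 = (2 * n + 1) + 2 by ring,
      show 2 * (n + 1) + 2 = (2 * n + 2) + 2 by ring, alt_two, alt_two cs j k (2 * n + 2), ← ih]
    simp only [mul_assoc]

lemma N_alt (j k : B) (m : ℕ) (t : W) (h : N cs hra (alt cs j k m) t ≠ 0) :
    ∃ n, t = alt cs j k (2 * n + 1) := by
  induction m generalizing j k t with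
  | zero => simp [alt, N_one] at h
  | succ m ih =>
    rw [alt, N_simple_mul] at h
    simp only [act] at h
    by_cases ht : t = cs.simple j
    · exact ⟨0, by simp [ht, alt]⟩
    · rw [if_neg ht, zero_add] at h
      obtain ⟨n, hn⟩ := ih _ _ _ h
      refine ⟨n + 1, ?_⟩
      have : t = cs.simple j * (cs.simple j * t * cs.simple j) * cs.simple j := by
        simp [mul_assoc]
      rw [this, hn, mul_assoc, alt_odd_mul]
      rfl

lemma exists_permHom (hra : RA M) {j k : B} (hne : j ≠ k) (h0 : M j k = 0) :
    ∃ f : W →* Function.End ℤ,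
    (∀ x, f (cs.simple j) x = -1 - x) ∧ (∀ x, f (cs.simple k) x = 1 - x) := by
  classical
  let g : B → Function.End ℤ := fun l =>
    if l = j then (fun x => -1 - x) else if l = k then (fun x => 1 - x) else 1
  have hsq : ∀ l, g l * g l = 1 := by
    intro l
    funext x
    change g l (g l x) = x
    by_cases h1 : l = j
    · simp [g, h1]
    · by_cases h2 : l = k
      · simp [g, h2, Ne.symm hne]
      · have : g l = 1 := by simp [g, h1, h2]
        rw [this]; rfl
  have hl : M.IsLiftable g := by
    intro a b
    by_cases hab : a = b
    · subst hab
      rw [M.diagonal, pow_one, hsq]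
    · rcases hra a b hab with h | h
      · rw [h, pow_two]
        by_cases ha : a = j ∨ a = k
        · by_cases hb : b = j ∨ b = k
          · exfalso
            rcases ha with rfl | rfl <;> rcases hb with rfl | rfl
            · exact hab rfl
            · omega
            · rw [M.symmetric] at h; omega
            · exact hab rfl
          · have : g b = 1 := by simp only [g]; push Not at hb; simp [hb]
            rw [this, mul_one, hsq]
        · have : g a = 1 := by simp only [g]; push Not at ha; simp [ha]
          rw [this, one_mul, hsq]
      · rw [h, pow_zero]
  refine ⟨cs.lift ⟨g, hl⟩, ?_, ?_⟩
  · intro x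
    rw [CoxeterSystem.lift_apply_simple]
    simp [g]
  · intro x
    rw [CoxeterSystem.lift_apply_simple]
    simp [g, Ne.symm hne]

lemma alt_ne (hra : RA M) {j k : B} (hne : j ≠ k) (h0 : M j k = 0) (n : ℕ) :
    alt cs j k (n + 1) ≠ cs.simple k := by
  obtain ⟨f, hj, hk⟩ := exists_permHom cs hra hne h0
  have key : ∀ n, f (alt cs j k (n + 1)) 0 < 0 ∧ 0 < f (alt cs k j (n + 1)) 0 := by
    intro n
    induction n with
    | zero =>
      simp only [alt, mul_one]
      rw [hj, hk]; omega
    | succ n ih =>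
      rw [show alt cs j k (n + 1 + 1) = cs.simple j * alt cs k j (n + 1) from rfl,
        show alt cs k j (n + 1 + 1) = cs.simple k * alt cs j k (n + 1) from rfl,
        map_mul, map_mul]
      change f (cs.simple j) (f (alt cs k j (n + 1)) 0) < 0 ∧
        0 < f (cs.simple k) (f (alt cs j k (n + 1)) 0)
      rw [hj, hk]
      omega
  intro h
  have := (key n).1
  rw [h, hk] at this
  omega

lemma alt_desc_ne (hra : RA M) {j k : B} (hne : j ≠ k) (h0 : M j k = 0) (m : ℕ) :
    ¬ cs.IsLeftDescent (alt cs j k m) k := by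
  rw [← N_simple_iff cs hra]
  intro h
  obtain ⟨n, hn⟩ := N_alt cs hra _ _ _ _ h
  exact alt_ne cs hra hne h0 _ hn.symm

lemma alt_desc (hra : RA M) {j k : B} (hne : j ≠ k) (h0 : M j k = 0) (m : ℕ) (l : B)
    (hl : cs.IsLeftDescent (alt cs j k m) l) : l = j := by
  by_contra hlj
  by_cases hlk : l = k
  · subst hlk; exact alt_desc_ne cs hra hne h0 m hl
  · rw [← N_simple_iff cs hra] at hl
    obtain ⟨n, hn⟩ := N_alt cs hra _ _ _ _ hl
    obtain ⟨f, h1, h2⟩ := exists_hom cs hra l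
    apply h1
    rw [hn]
    clear hl hn
    generalize 2 * n + 1 = p
    have : ∀ p, f (alt cs j k p) = 1 ∧ f (alt cs k j p) = 1 := by
      intro p
      induction p with
      | zero => simp [alt]
      | succ p ih =>
        rw [alt, alt, map_mul, map_mul, ih.1, ih.2, h2 j (Ne.symm hlj), h2 k (Ne.symm hlk)]
        simp
    exact (this p).1

lemma alt_length (hra : RA M) {j k : B} (hne : j ≠ k) (h0 : M j k = 0) (m : ℕ) :
    cs.length (alt cs j k m) = m ∧ cs.length (alt cs k j m) = m := by
  have h0' : M k j = 0 := by rw [M.symmetric]; exact h0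
  induction m with
  | zero => simp [alt]
  | succ m ih =>
    have a := cs.not_isLeftDescent_iff.mp (alt_desc_ne cs hra hne h0 m)
    have b := cs.not_isLeftDescent_iff.mp (alt_desc_ne cs hra hne.symm h0' m)
    rw [alt, alt]
    omega

/-- Two distinct descents commute. -/
lemma desc_two (hra : RA M) {j k : B} (hne : j ≠ k) {w : W} (hj : cs.IsLeftDescent w j)
    (hk : cs.IsLeftDescent w k) : M j k = 2 := by
  rcases hra j k hne with h | h0
  · exact h
  exfalso
  have h0' : M k j = 0 := by rw [M.symmetric]; exact h0
  let D : Subgroup W := Subgroup.closure {cs.simple j, cs.simple k}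
  have hDj : cs.simple j ∈ D := Subgroup.subset_closure (by simp)
  have hDk : cs.simple k ∈ D := Subgroup.subset_closure (by simp)
  -- minimal element
  obtain ⟨b, ⟨hbD, hbmin⟩⟩ : ∃ b, b * w⁻¹ ∈ D ∧ ∀ d ∈ D, cs.length b ≤ cs.length (d * b) := by
    have hex : ∃ n, ∃ b, b * w⁻¹ ∈ D ∧ cs.length b = n := ⟨_, w, by simp [D.one_mem], rfl⟩
    classical
    obtain ⟨b, hb, hbn⟩ := Nat.find_spec hex
    refine ⟨b, hb, fun d hd => ?_⟩
    rw [hbn]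
    exact Nat.find_min' hex ⟨d * b, by rw [mul_assoc]; exact D.mul_mem hd hb, rfl⟩
  have hNb : ∀ t ∈ D, N cs hra b t = 0 := by
    intro t ht
    by_contra h
    have := N_lt cs hra h
    have := hbmin t ht
    omega
  -- all elements of D are alternating
  have hDalt : ∀ d ∈ D, ∃ m, d = alt cs j k m ∨ d = alt cs k j m := by
    have step : ∀ a b : B, ∀ d : W, (∃ m, d = alt cs a b m ∨ d = alt cs b a m) →
        ∃ m, cs.simple a * d = alt cs a b m ∨ cs.simple a * d = alt cs b a m := by
      rintro a b d ⟨m, rfl | rfl⟩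
      · cases m with
        | zero => exact ⟨1, Or.inl rfl⟩
        | succ m => exact ⟨m, Or.inr (by simp [alt])⟩
      · exact ⟨m + 1, Or.inl rfl⟩
    intro d hd
    induction hd using Subgroup.closure_induction_left with
    | one => exact ⟨0, Or.inl rfl⟩
    | mul_left x hx y hy ih =>
      rcases hx with rfl | hx
      · exact step _ _ _ ih
      · rw [Set.mem_singleton_iff] at hx; subst hx
        obtain ⟨m, h⟩ := ih
        obtain ⟨m', h'⟩ := step k j y ⟨m, h.symm⟩
        exact ⟨m', h'.symm⟩
    | inv_mul_cancel x hx y hy ih =>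
      rcases hx with rfl | hx
      · rw [cs.inv_simple]; exact step _ _ _ ih
      · rw [Set.mem_singleton_iff] at hx; subst hx
        rw [cs.inv_simple]
        obtain ⟨m, h⟩ := ih
        obtain ⟨m', h'⟩ := step k j y ⟨m, h.symm⟩
        exact ⟨m', h'.symm⟩
  have hNalt : ∀ m, (∀ t ∈ D, N cs hra (alt cs j k m * b) t = N cs hra (alt cs j k m) t) ∧
      (∀ t ∈ D, N cs hra (alt cs k j m * b) t = N cs hra (alt cs k j m) t) := by
    intro m
    induction m with
    | zero =>
      simp only [alt, one_mul, N_one]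
      exact ⟨hNb, hNb⟩
    | succ m ih =>
      simp only [alt, mul_assoc, N_simple_mul]
      constructor
      · intro t ht
        simp only [act]
        rw [ih.2 _ (D.mul_mem (D.mul_mem hDj ht) hDj)]
      · intro t ht
        simp only [act]
        rw [ih.1 _ (D.mul_mem (D.mul_mem hDk ht) hDk)]
  obtain ⟨m, hm⟩ := hDalt (b * w⁻¹)⁻¹ (D.inv_mem hbD)
  have hw : w = (b * w⁻¹)⁻¹ * b := by simp
  rw [← N_simple_iff cs hra] at hj hk
  rcases hm with hm | hm
  · rw [hw, hm, (hNalt m).1 _ hDk, N_simple_iff] at hk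
    exact alt_desc_ne cs hra hne h0 m hk
  · rw [hw, hm, (hNalt m).2 _ hDj, N_simple_iff] at hj
    exact alt_desc_ne cs hra hne.symm h0' m hj

end Cox
end RAB

namespace RAB

/-- Building axioms, bundled. -/
structure Bldg {B W : Type*} [Group W] {M : CoxeterMatrix B} (cs : CoxeterSystem M W)
    {Δ : Type*} (δ : Δ → Δ → W) : Prop where
  wd1 : ∀ C D : Δ, δ C D = 1 ↔ C = D
  wd2 : ∀ (C C' D : Δ) (i : B), δ C' C = cs.simple i →
      (δ C' D = cs.simple i * δ C D ∨ δ C' D = δ C D) ∧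
      (cs.length (cs.simple i * δ C D) = cs.length (δ C D) + 1 →
        δ C' D = cs.simple i * δ C D)
  wd3 : ∀ (C D : Δ) (i : B), ∃ C' : Δ,
      δ C' C = cs.simple i ∧ δ C' D = cs.simple i * δ C D
  ra : RA M

/-- the panel relation -/
def Adj {B W : Type*} [Group W] {M : CoxeterMatrix B} (cs : CoxeterSystem M W)
    {Δ : Type*} (δ : Δ → Δ → W) (j : B) (x y : Δ) : Prop := δ x y = 1 ∨ δ x y = cs.simple j

/-- legal colourings -/
structure Legal {B W : Type*} [Group W] {M : CoxeterMatrix B} (cs : CoxeterSystem M W)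
    {Δ : Type*} (δ : Δ → Δ → W) (j : B) {Y : Type*} (h : Δ → Y) : Prop where
  inj : ∀ x y, Adj cs δ j x y → h x = h y → x = y
  surj : ∀ x c, ∃ y, Adj cs δ j x y ∧ h y = c
  const : ∀ k, k ≠ j → ∀ x y, Adj cs δ k x y → h x = h y

section Bd
variable {B W : Type*} [Group W] {M : CoxeterMatrix B} {cs : CoxeterSystem M W}
  {Δ : Type*} {δ : Δ → Δ → W}

lemma simple_ne_one (j : B) : cs.simple j ≠ 1 := by
  intro h
  have := cs.length_simple j
  rw [h, cs.length_one] at this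
  omega

lemma dself (b : Bldg cs δ) (x : Δ) : δ x x = 1 := (b.wd1 x x).2 rfl

lemma dsymm (b : Bldg cs δ) {x y : Δ} {j : B} (h : δ x y = cs.simple j) : δ y x = cs.simple j := by
  rcases (b.wd2 y x x j h).1 with h1 | h1
  · rw [dself b] at h1
    have := eq_inv_of_mul_eq_one_right h1.symm
    simpa using this
  · rw [dself b] at h1
    have := (b.wd1 _ _).1 h1.symm
    subst this
    rw [dself b] at h
    exact absurd h.symm (simple_ne_one j)

lemma adj_refl (b : Bldg cs δ) (j : B) (x : Δ) : Adj cs δ j x x := Or.inl (dself b x)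

lemma adj_symm (b : Bldg cs δ) {j : B} {x y : Δ} (h : Adj cs δ j x y) : Adj cs δ j y x := by
  rcases h with h | h
  · rw [b.wd1] at h; subst h; exact adj_refl b j _
  · exact Or.inr (dsymm b h)

lemma adj_trans (b : Bldg cs δ) {j : B} {x y z : Δ} (h : Adj cs δ j x y) (h' : Adj cs δ j y z) :
    Adj cs δ j x z := by
  rcases h with h | h
  · rw [b.wd1] at h; subst h; exact h'
  · rcases (b.wd2 y x z j h).1 with h1 | h1
    · rcases h' with h' | h'
      · rw [h', mul_one] at h1; exact Or.inr h1
      · rw [h'] at h1; left; simpa using h1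
    · unfold Adj; rw [h1]; exact h'

lemma adj_inter (b : Bldg cs δ) {j k : B} (hne : j ≠ k) {x y : Δ} (h : Adj cs δ j x y) (h' : Adj cs δ k x y) :
    x = y := by
  rcases h with h | h
  · exact (b.wd1 _ _).1 h
  · rcases h' with h' | h'
    · exact (b.wd1 _ _).1 h'
    · exact absurd (simple_inj cs b.ra (h.symm.trans h')) hne

lemma adj_ne (b : Bldg cs δ) {j : B} {x y : Δ} (h : Adj cs δ j x y) (hne : x ≠ y) : δ x y = cs.simple j := by
  rcases h with h | h
  · exact absurd ((b.wd1 _ _).1 h) hne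
  · exact h

/-- commuting squares -/
lemma square (b : Bldg cs δ) {j k : B} (h2 : M j k = 2) {x y z : Δ} (h : Adj cs δ j x y)
    (h' : Adj cs δ k y z) : ∃ y', Adj cs δ k x y' ∧ Adj cs δ j y' z := by
  rcases h with h | h
  · rw [b.wd1] at h; subst h; exact ⟨z, h', adj_refl b _ _⟩
  rcases h' with h' | h'
  · rw [b.wd1] at h'; subst h'; exact ⟨x, adj_refl b _ _, Or.inr h⟩
  have hjk : j ≠ k := by
    rintro rfl
    rw [M.diagonal] at h2; omega
  rcases (b.wd2 y x z j h).1 with h1 | h1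
  · obtain ⟨y', a1, a2⟩ := b.wd3 x z k
    refine ⟨y', adj_symm b (Or.inr a1), Or.inr ?_⟩
    rw [a2, h1, h', comm_of_two cs h2]
    simp
  · have := (b.wd2 y x z j h).2
    rw [h1, h'] at this
    exact ⟨z, Or.inr (h1.trans h'), adj_refl b _ _⟩

lemma adj_weight (b : Bldg cs δ) {j : B} {x y : Δ} (h : Adj cs δ j x y) (c : Δ) :
    δ x c = δ y c ∨ δ x c = cs.simple j * δ y c := by
  rcases h with h | h
  · rw [b.wd1] at h; subst h; exact Or.inl rfl
  · exact (b.wd2 y x c j h).1.symm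

/-- A chamber which is not a descent chamber is the gate of its panel. -/
lemma gate_weight (b : Bldg cs δ) {j : B} {x g : Δ} (c : Δ) (h : Adj cs δ j x g) (hne : x ≠ g)
    (hg : ¬ cs.IsLeftDescent (δ g c) j) : δ x c = cs.simple j * δ g c :=
  (b.wd2 g x c j (adj_ne b h hne)).2 (cs.not_isLeftDescent_iff.1 hg)

lemma connected (b : Bldg cs δ) {P : Δ → Prop} (c : Δ) (hc : P c)
    (hP : ∀ j x y, Adj cs δ j x y → P x → P y) (x : Δ) : P x := by
  generalize hn : cs.length (δ x c) = n
  induction n using Nat.strong_induction_on generalizing x with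
  | _ n ih =>
  by_cases h1 : δ x c = 1
  · rw [b.wd1] at h1; subst h1; exact hc
  · obtain ⟨j, hj⟩ := cs.exists_leftDescent_of_ne_one h1
    obtain ⟨y, hy1, hy2⟩ := b.wd3 x c j
    refine hP j y x (Or.inr hy1) (ih _ ?_ y rfl)
    rw [hy2, ← hn]
    exact hj

lemma isom_of_adj (b : Bldg cs δ) (f : Δ → Δ) (hf : ∀ j x y, Adj cs δ j x y → Adj cs δ j (f x) (f y))
    (hf' : ∀ j x y, Adj cs δ j x y → x ≠ y → f x ≠ f y) (x y : Δ) :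
    δ (f x) (f y) = δ x y := by
  generalize hn : cs.length (δ x y) = n
  induction n using Nat.strong_induction_on generalizing x with
  | _ n ih =>
  by_cases h1 : δ x y = 1
  · rw [h1]
    rw [b.wd1] at h1; subst h1; exact dself b _
  · obtain ⟨j, hj⟩ := cs.exists_leftDescent_of_ne_one h1
    obtain ⟨z, hz1, hz2⟩ := b.wd3 x y j
    have hlt : cs.length (δ z y) < n := by
      rw [hz2, ← hn]; exact hj
    have h2 := ih _ hlt z rfl
    have hxz : δ x z = cs.simple j := dsymm b hz1
    have hxne : x ≠ z := by
      rintro rfl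
      rw [dself b] at hxz
      exact simple_ne_one j hxz.symm
    have h3 := adj_ne b (hf j x z (Or.inr hxz)) (hf' j x z (Or.inr hxz) hxne)
    have h4 := (b.wd2 (f z) (f x) (f y) j h3).2
    rw [h2, hz2] at h4
    rw [h4]
    · simp
    · rw [cs.simple_mul_simple_cancel_left]
      have := cs.isLeftDescent_iff.1 hj
      omega

/-- the gate -/
noncomputable def gate (b : Bldg cs δ) (c : Δ) (k : B) (x : Δ) : Δ := Classical.choose (b.wd3 x c k)

lemma gate_adj (b : Bldg cs δ) (c : Δ) (k : B) (x : Δ) : Adj cs δ k (gate b c k x) x :=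
  Or.inr (Classical.choose_spec (b.wd3 x c k)).1

lemma gate_w (b : Bldg cs δ) (c : Δ) (k : B) (x : Δ) : δ (gate b c k x) c = cs.simple k * δ x c :=
  (Classical.choose_spec (b.wd3 x c k)).2

lemma gate_lt (b : Bldg cs δ) {c : Δ} {k : B} {x : Δ} (h : cs.IsLeftDescent (δ x c) k) :
    cs.length (δ (gate b c k x) c) < cs.length (δ x c) := by
  rw [gate_w b]; exact h

lemma smul_ne (k : B) (w : W) : cs.simple k * w ≠ w := by
  intro h
  exact simple_ne_one k (mul_eq_right.1 h)

lemma desc_smul {k : B} {w : W} :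
    cs.IsLeftDescent (cs.simple k * w) k ↔ ¬ cs.IsLeftDescent w k := by
  rw [cs.isLeftDescent_iff_not_isLeftDescent_mul]
  simp

lemma gate_uniq (b : Bldg cs δ) {c : Δ} {k : B} {x y : Δ} (h : cs.IsLeftDescent (δ x c) k)
    (ha : Adj cs δ k y x) (hw : δ y c = cs.simple k * δ x c) : y = gate b c k x := by
  by_contra hne
  have h1 : Adj cs δ k y (gate b c k x) := adj_trans b ha (adj_symm b (gate_adj b c k x))
  have h2 : ¬ cs.IsLeftDescent (δ (gate b c k x) c) k := by
    rw [gate_w b, desc_smul]; simpa using h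
  have := gate_weight b c h1 hne h2
  rw [gate_w b, hw] at this
  exact smul_ne k _ this.symm

/-- the gate of a panel containing a non-descent chamber -/
lemma gate_eq (b : Bldg cs δ) {c : Δ} {k : B} {x g : Δ} (ha : Adj cs δ k x g) (hne : x ≠ g)
    (hg : ¬ cs.IsLeftDescent (δ g c) k) :
    cs.IsLeftDescent (δ x c) k ∧ g = gate b c k x := by
  have hw := gate_weight b c ha hne hg
  have hd : cs.IsLeftDescent (δ x c) k := by rw [hw, desc_smul]; exact hg
  refine ⟨hd, gate_uniq b hd (adj_symm b ha) ?_⟩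
  rw [hw]; simp

/-- every panel has a gate -/
lemma panel_gate (b : Bldg cs δ) (c : Δ) (k : B) (x : Δ) : ∃ g, Adj cs δ k x g ∧
    ¬ cs.IsLeftDescent (δ g c) k := by
  by_cases h : cs.IsLeftDescent (δ x c) k
  · refine ⟨gate b c k x, adj_symm b (gate_adj b c k x), ?_⟩
    rw [gate_w b, desc_smul]; simpa using h
  · exact ⟨x, adj_refl b _ _, h⟩

/-- gate in a commuting direction is compatible with adjacency -/
lemma gate_square (b : Bldg cs δ) {c : Δ} {j k : B} (hne : j ≠ k) (h2 : M j k = 2) {x g : Δ}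
    (hk : cs.IsLeftDescent (δ g c) k) (ha : Adj cs δ j x g)
    (hw : δ x c = cs.simple j * δ g c) : cs.IsLeftDescent (δ x c) k ∧
    Adj cs δ j (gate b c k x) (gate b c k g) := by
  have hkx : cs.IsLeftDescent (δ x c) k := by
    rw [hw, desc_comm cs b.ra hne h2]; exact hk
  refine ⟨hkx, ?_⟩
  obtain ⟨y, hy1, hy2⟩ := square b h2 ha (adj_symm b (gate_adj b c k g))
  have hsne : cs.simple j ≠ cs.simple k := fun h => hne (simple_inj cs b.ra h)
  have : y = gate b c k x := by
    apply gate_uniq b hkx (adj_symm b hy1)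
    rcases adj_weight b (adj_symm b hy1) c with h | h
    · exfalso
      rcases adj_weight b hy2 c with h' | h' <;> rw [h, hw, gate_w b] at h'
      · exact hsne (mul_right_cancel h')
      · exact smul_ne k _ (mul_left_cancel h').symm
    · exact h
  rw [← this]; exact hy2

lemma gate_comm (b : Bldg cs δ) {c : Δ} {j k : B} (hne : j ≠ k) {x : Δ}
    (hj : cs.IsLeftDescent (δ x c) j) (hk : cs.IsLeftDescent (δ x c) k) :
    M j k = 2 ∧ cs.IsLeftDescent (δ (gate b c j x) c) k ∧
    gate b c j (gate b c k x) = gate b c k (gate b c j x) := by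
  have h2 := desc_two cs b.ra hne hj hk
  have h2' : M k j = 2 := by rw [M.symmetric]; exact h2
  have d1 : cs.IsLeftDescent (δ (gate b c k x) c) j := by
    rw [gate_w b, desc_comm cs b.ra hne.symm h2']; exact hj
  obtain ⟨hd, ha⟩ := gate_square b hne h2 hk (gate_adj b c j x) (gate_w b c j x)
  refine ⟨h2, hd, ?_⟩
  symm
  apply gate_uniq b d1 ha
  rw [gate_w b, gate_w b, gate_w b, ← mul_assoc, ← mul_assoc, comm_of_two cs h2]

/-- existence of colourings -/
lemma exists_col (b : Bldg cs δ) (c : Δ) (j : B) {Y : Type*} [Nonempty Y] (E : Δ → Y → Δ → Y) :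
    ∃ h : Δ → Y, (∀ x k, k ≠ j → cs.IsLeftDescent (δ x c) k → h x = h (gate b c k x)) ∧
      (∀ x, cs.IsLeftDescent (δ x c) j → (∀ k, cs.IsLeftDescent (δ x c) k → k = j) →
        h x = E (gate b c j x) (h (gate b c j x)) x) := by
  classical
  let len : Δ → ℕ := fun x => cs.length (δ x c)
  let F : (x : Δ) → ((y : Δ) → len y < len x → Y) → Y := fun x ih =>
    if hx : ∃ k, k ≠ j ∧ cs.IsLeftDescent (δ x c) k then
      ih (gate b c hx.choose x) (gate_lt b hx.choose_spec.2)
    else if hj : cs.IsLeftDescent (δ x c) j then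
      E (gate b c j x) (ih (gate b c j x) (gate_lt b hj)) x
    else Classical.arbitrary Y
  let wf : WellFounded (fun x y : Δ => len x < len y) := (measure len).wf
  let h : Δ → Y := wf.fix F
  have hh : ∀ x, h x = F x (fun y _ => h y) := fun x => wf.fix_eq F x
  refine ⟨h, ?_, ?_⟩
  · intro x
    generalize hn : len x = n
    induction n using Nat.strong_induction_on generalizing x with
    | _ n ih =>
    intro k hkj hk
    have hx : ∃ k, k ≠ j ∧ cs.IsLeftDescent (δ x c) k := ⟨k, hkj, hk⟩
    have h1 : h x = h (gate b c hx.choose x) := by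
      rw [hh x]; simp only [F]; rw [dif_pos hx]
    obtain ⟨l, hl, hlj, hld⟩ : ∃ l, hx.choose = l ∧ l ≠ j ∧ cs.IsLeftDescent (δ x c) l :=
      ⟨_, rfl, hx.choose_spec⟩
    rw [hl] at h1
    by_cases hlk : l = k
    · rw [h1, hlk]
    · obtain ⟨_, a1, a2⟩ := gate_comm b hlk hld hk
      obtain ⟨_, a3, _⟩ := gate_comm b (Ne.symm hlk) hk hld
      rw [h1, ih _ (by rw [← hn]; exact gate_lt b hld) _ rfl k hkj a1,
        ih _ (by rw [← hn]; exact gate_lt b hk) (gate b c k x) rfl l hlj a3, a2]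
  · intro x hj hall
    have hx : ¬ ∃ k, k ≠ j ∧ cs.IsLeftDescent (δ x c) k := by
      rintro ⟨k, h1, h2⟩; exact h1 (hall k h2)
    rw [hh x]
    simp only [F]
    rw [dif_neg hx, dif_pos hj]

lemma exists_legal (b : Bldg cs δ) (c : Δ) (j : B) {Y : Type*} [Nonempty Y] [Finite Y]
    (hfin : ∀ C : Δ, {D : Δ | Adj cs δ j C D}.Finite)
    (hcard : ∀ C : Δ, {D : Δ | Adj cs δ j C D}.ncard = Nat.card Y)
    (E : Δ → Y → Δ → Y) (hE : ∀ g y, E g y g = y)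
    (hEinj : ∀ g y, Set.InjOn (E g y) {D : Δ | Adj cs δ j g D}) :
    ∃ h : Δ → Y, Legal cs δ j h ∧
      (∀ x, cs.IsLeftDescent (δ x c) j → (∀ k, cs.IsLeftDescent (δ x c) k → k = j) →
        h x = E (gate b c j x) (h (gate b c j x)) x) := by
  obtain ⟨h, h1, h2⟩ := exists_col b c j E
  have hconst : ∀ k, k ≠ j → ∀ x y, Adj cs δ k x y → h x = h y := by
    intro k hk
    have : ∀ x g, Adj cs δ k x g → ¬ cs.IsLeftDescent (δ g c) k → h x = h g := by
      intro x g ha hg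
      by_cases hne : x = g
      · rw [hne]
      · obtain ⟨hd, hge⟩ := gate_eq b ha hne hg
        rw [hge]; exact h1 x k hk hd
    intro x y ha
    obtain ⟨g, hg1, hg2⟩ := panel_gate b c k x
    rw [this x g hg1 hg2, this y g (adj_trans b (adj_symm b ha) hg1) hg2]
  have hinj0 : ∀ n g, cs.length (δ g c) = n → ¬ cs.IsLeftDescent (δ g c) j →
      ∀ x y, Adj cs δ j g x → Adj cs δ j g y → h x = h y → x = y := by
    intro n
    induction n using Nat.strong_induction_on with
    | _ n ih =>
    intro g hn hg x y hx hy hxy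
    by_cases hex : ∃ k, k ≠ j ∧ cs.IsLeftDescent (cs.simple j * δ g c) k
    · obtain ⟨k, hkj, hk⟩ := hex
      have hj : cs.IsLeftDescent (cs.simple j * δ g c) j := desc_smul.2 hg
      have hM : M j k = 2 := desc_two cs b.ra hkj.symm hj hk
      rw [desc_comm cs b.ra hkj.symm hM] at hk
      have hM' : M k j = 2 := by rw [M.symmetric]; exact hM
      have key : ∀ x, Adj cs δ j g x → h x = h (gate b c k x) ∧
          Adj cs δ j (gate b c k g) (gate b c k x) := by
        intro x hx
        by_cases hne : x = g
        · subst hne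
          exact ⟨h1 x k hkj hk, adj_refl b _ _⟩
        · obtain ⟨a1, a2⟩ := gate_square b hkj.symm hM hk (adj_symm b hx)
            (gate_weight b c (adj_symm b hx) hne hg)
          exact ⟨h1 x k hkj a1, adj_symm b a2⟩
      obtain ⟨kx1, kx2⟩ := key x hx
      obtain ⟨ky1, ky2⟩ := key y hy
      have hgg := ih _ (by rw [← hn]; exact gate_lt b hk) (gate b c k g) rfl
        (by rw [gate_w b, desc_comm cs b.ra hkj hM']; exact hg) _ _ kx2 ky2
        (by rw [← kx1, ← ky1, hxy])
      apply adj_inter b hkj.symm (adj_trans b (adj_symm b hx) hy)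
      have := gate_adj b c k x
      rw [hgg] at this
      exact adj_trans b (adj_symm b this) (gate_adj b c k y)
    · have key : ∀ x, Adj cs δ j g x → h x = E g (h g) x := by
        intro x hx
        by_cases hne : x = g
        · subst hne; exact (hE _ _).symm
        · have hw := gate_weight b c (adj_symm b hx) hne hg
          obtain ⟨hd, hge⟩ := gate_eq b (adj_symm b hx) hne hg
          rw [h2 x hd, ← hge]
          intro k hk
          by_contra hkj
          exact hex ⟨k, hkj, by rw [← hw]; exact hk⟩
      rw [key x hx, key y hy] at hxy
      exact hEinj g (h g) hx hy hxy
  have hinj : ∀ x y, Adj cs δ j x y → h x = h y → x = y := by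
    intro x y ha
    obtain ⟨g, hg1, hg2⟩ := panel_gate b c j x
    exact hinj0 _ g rfl hg2 x y (adj_symm b hg1) (adj_trans b (adj_symm b hg1) ha)
  refine ⟨h, ⟨hinj, ?_, hconst⟩, h2⟩
  intro x y
  have hIn : Set.InjOn h {D : Δ | Adj cs δ j x D} := by
    intro u hu v hv huv
    exact hinj u v (adj_trans b (adj_symm b hu) hv) huv
  have hc : (h '' {D : Δ | Adj cs δ j x D}).ncard = Nat.card Y := by
    rw [hIn.ncard_image, hcard]
  have : h '' {D : Δ | Adj cs δ j x D} = Set.univ :=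
    Set.eq_of_subset_of_ncard_le (Set.subset_univ _) (by rw [Set.ncard_univ, hc])
  have hy : y ∈ h '' {D : Δ | Adj cs δ j x D} := by rw [this]; trivial
  obtain ⟨z, hz1, hz2⟩ := hy
  exact ⟨z, hz1, hz2⟩

/-- two legal colourings yield an automorphism -/
lemma exists_aut (b : Bldg cs δ) (c : Δ) {Y : B → Type*} (h h' : ∀ j, Δ → Y j)
    (hl : ∀ j, Legal cs δ j (h j)) (hl' : ∀ j, Legal cs δ j (h' j)) 
    (hc : ∃ c', ∀ j, h' j c' = h j c) :
    ∃ f : Δ ≃ Δ, (∀ x y, δ (f x) (f y) = δ x y) ∧ ∀ j x, h' j (f x) = h j x := by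
  classical
  obtain ⟨c', hc'⟩ := hc
  let len : Δ → ℕ := fun x => cs.length (δ x c)
  let F : (x : Δ) → ((y : Δ) → len y < len x → Δ) → Δ := fun x ih =>
    if hx : ∃ k, cs.IsLeftDescent (δ x c) k then
      ((hl' hx.choose).surj (ih (gate b c hx.choose x) (gate_lt b hx.choose_spec))
        (h hx.choose x)).choose
    else c'
  let wf : WellFounded (fun x y : Δ => len x < len y) := (measure len).wf
  let f : Δ → Δ := wf.fix F
  have hf : ∀ x, f x = F x (fun y _ => f y) := fun x => wf.fix_eq F x
  have hmain : ∀ n x, len x = n → (∀ j, h' j (f x) = h j x) ∧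
      ∀ k, cs.IsLeftDescent (δ x c) k → Adj cs δ k (f (gate b c k x)) (f x) := by
    intro n
    induction n using Nat.strong_induction_on with
    | _ n ih =>
    intro x hn
    by_cases hx : ∃ k, cs.IsLeftDescent (δ x c) k
    · obtain ⟨j, hjd, hj⟩ : ∃ j, cs.IsLeftDescent (δ x c) j ∧
          (Adj cs δ j (f (gate b c j x)) (f x) ∧ h' j (f x) = h j x) := by
        refine ⟨hx.choose, hx.choose_spec, ?_⟩
        have : f x = ((hl' hx.choose).surj (f (gate b c hx.choose x)) (h hx.choose x)).choose := by
          rw [hf x]; simp only [F]; rw [dif_pos hx]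
        rw [this]
        exact ((hl' hx.choose).surj (f (gate b c hx.choose x)) (h hx.choose x)).choose_spec
      obtain ⟨hja, hjc⟩ := hj
      have ihj := ih _ (by rw [← hn]; exact gate_lt b hjd) (gate b c j x) rfl
      have hcol : ∀ k, h' k (f x) = h k x := by
        intro k
        by_cases hkj : k = j
        · subst hkj; exact hjc
        · rw [← (hl' k).const j (Ne.symm hkj) _ _ hja, ihj.1,
            (hl k).const j (Ne.symm hkj) _ _ (gate_adj b c j x)]
      refine ⟨hcol, ?_⟩
      intro k hkd
      by_cases hkj : k = j
      · subst hkj; exact hja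
      · obtain ⟨hM, a1, a2⟩ := gate_comm b (Ne.symm hkj) hjd hkd
        obtain ⟨hM', a3, _⟩ := gate_comm b hkj hkd hjd
        have ihk := ih _ (by rw [← hn]; exact gate_lt b hkd) (gate b c k x) rfl
        have e1 := ihj.2 k a1
        have e2 := ihk.2 j a3
        rw [a2] at e2
        obtain ⟨y, hy1, hy2⟩ := square b hM' e1 hja
        have hyy : f (gate b c k x) = y := by
          apply (hl' j).inj _ _ (adj_trans b (adj_symm b e2) hy1)
          rw [ihk.1, (hl' j).const k hkj _ _ hy2, hjc,
            (hl j).const k hkj _ _ (gate_adj b c k x)]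
        rw [hyy]; exact hy2
    · have hxc : x = c := by
        by_contra hne
        exact hx (cs.exists_leftDescent_of_ne_one (fun h => hne ((b.wd1 _ _).1 h)))
      have : f x = c' := by
        rw [hf x]; simp only [F]; rw [dif_neg hx]
      refine ⟨fun j => by rw [this, hxc, hc'], fun k hk => absurd ⟨k, hk⟩ hx⟩
  have hcol : ∀ j x, h' j (f x) = h j x := fun j x => (hmain _ x rfl).1 j
  have hgate : ∀ k x g, Adj cs δ k x g → ¬ cs.IsLeftDescent (δ g c) k →
      Adj cs δ k (f g) (f x) := by
    intro k x g ha hg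
    by_cases hne : x = g
    · rw [hne]; exact adj_refl b _ _
    · obtain ⟨hd, hge⟩ := gate_eq b ha hne hg
      rw [hge]; exact (hmain _ x rfl).2 k hd
  have hadj : ∀ k x y, Adj cs δ k x y → Adj cs δ k (f x) (f y) := by
    intro k x y ha
    obtain ⟨g, hg1, hg2⟩ := panel_gate b c k x
    exact adj_trans b (adj_symm b (hgate k x g hg1 hg2))
      (hgate k y g (adj_trans b (adj_symm b ha) hg1) hg2)
  have hadj' : ∀ k x y, Adj cs δ k x y → x ≠ y → f x ≠ f y := by
    intro k x y ha hne hfe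
    apply hne
    apply (hl k).inj x y ha
    rw [← hcol, ← hcol, hfe]
  have hiso := isom_of_adj b f hadj hadj'
  have hbij : Function.Bijective f := by
    constructor
    · intro x y hxy
      rw [← b.wd1, ← hiso, b.wd1]; exact hxy
    · intro y
      refine connected b (P := fun y => ∃ x, f x = y) (f c) ⟨c, rfl⟩ ?_ y
      rintro j _ z ha ⟨x, rfl⟩
      obtain ⟨x', hx1, hx2⟩ := (hl j).surj x (h' j z)
      refine ⟨x', (hl' j).inj _ _ (adj_trans b (adj_symm b (hadj j x x' hx1)) ha) ?_⟩
      rw [hcol, hx2]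
  exact ⟨Equiv.ofBijective f hbij, hiso, hcol⟩

lemma exists_weight (b : Bldg cs δ) (c : Δ) (w : W) : ∃ x, δ x c = w := by
  induction w using cs.simple_induction_left with
  | one => exact ⟨c, dself b c⟩
  | mul_simple_left w j ih =>
    obtain ⟨x, hx⟩ := ih
    obtain ⟨y, _, hy⟩ := b.wd3 x c j
    exact ⟨y, by rw [hy, hx]⟩

end Bd

/-- bijective relabelling with one prescribed and one forbidden value -/
lemma exists_E {Δ : Type*} {q : ℕ} (P : Set Δ) (hP : P.Finite) (hq : P.ncard = q) (g : Δ)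
    (hg : g ∈ P) (y : Fin q) : ∃ e : Δ → Fin q, e g = y ∧ Set.InjOn e P := by
  classical
  have : Finite P := hP
  have hc : Nat.card P = q := by
    rw [← hq]; rfl
  let e0 : P ≃ Fin q := Finite.equivFinOfCardEq hc
  let e1 : P ≃ Fin q := e0.trans (Equiv.swap (e0 ⟨g, hg⟩) y)
  refine ⟨fun x => if hx : x ∈ P then e1 ⟨x, hx⟩ else y, ?_, ?_⟩
  · simp only [dif_pos hg, e1]
    simp
  · intro u hu v hv huv
    simp only [dif_pos hu, dif_pos hv] at huv
    have := e1.injective huv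
    simpa using this

lemma exists_E' {Δ : Type*} {q : ℕ} (P : Set Δ) (hP : P.Finite) (hq : P.ncard = q)
    (h3 : 3 ≤ q) (g : Δ) (hg : g ∈ P) (y : Fin q) (x : Δ) (hx : x ∈ P) (hxg : x ≠ g)
    (d : Fin q) : ∃ e : Δ → Fin q, e g = y ∧ Set.InjOn e P ∧ e x ≠ d := by
  classical
  obtain ⟨e, h1, h2⟩ := exists_E P hP hq g hg y
  obtain ⟨z, hz1, hz2⟩ : ∃ z : Fin q, z ≠ y ∧ z ≠ d := by
    have : ({y, d} : Finset (Fin q)).card < (Finset.univ : Finset (Fin q)).card := by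
      rw [Finset.card_univ, Fintype.card_fin]
      exact lt_of_le_of_lt Finset.card_le_two h3
    obtain ⟨z, _, hz⟩ := Finset.exists_mem_notMem_of_card_lt_card this
    simp only [Finset.mem_insert, Finset.mem_singleton, not_or] at hz
    exact ⟨z, hz⟩
  have hexy : e x ≠ y := by
    rw [← h1]
    exact fun h => hxg (h2 hx hg h)
  refine ⟨fun u => Equiv.swap (e x) z (e u), ?_, ?_, ?_⟩
  · simp only [h1]
    exact Equiv.swap_apply_of_ne_of_ne hexy.symm hz1.symm
  · intro u hu v hv huv
    exact h2 hu hv ((Equiv.swap (e x) z).injective huv)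
  · simpa using hz2

end RAB

/-- Let `Δ` be a regular right angled building of type `(W, S)` with all
panels finite, and suppose there is an index `i : B` such that: (a) every `i`-panel has at
least 3 chambers; and (b) there is no finite subset `J ⊆ B` with `i ∈ J` such that
`M j j' = 2` for all distinct `j, j' ∈ J` and `M j k = 2` for all `j ∈ J` and all `k ∉ J`
(i.e. `sᵢ` is not contained in a finite direct factor of `W`).  Then the full (type
preserving) automorphism group of `Δ` — the group of bijections `G : Δ ≃ Δ` with
`δ (G C) (G D) = δ C D` for all `C`, `D` — is uncountable. -/
theorem aut_of_thick_rab_uncountable {B : Type*} {W : Type*} [Group W]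
    {M : CoxeterMatrix B} (cs : CoxeterSystem M W)
    {Δ : Type*} [Nonempty Δ] (δ : Δ → Δ → W)
    (hWD1 : ∀ C D : Δ, δ C D = 1 ↔ C = D)
    (hWD2 : ∀ (C C' D : Δ) (i : B), δ C' C = cs.simple i →
      (δ C' D = cs.simple i * δ C D ∨ δ C' D = δ C D) ∧
      (cs.length (cs.simple i * δ C D) = cs.length (δ C D) + 1 →
        δ C' D = cs.simple i * δ C D))
    (hWD3 : ∀ (C D : Δ) (i : B), ∃ C' : Δ,
      δ C' C = cs.simple i ∧ δ C' D = cs.simple i * δ C D)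
    -- right angled
    (hra : ∀ i j : B, i ≠ j → M i j = 2 ∨ M i j = 0)
    -- all panels are finite
    (hfin : ∀ (i : B) (C : Δ), {D : Δ | δ C D = 1 ∨ δ C D = cs.simple i}.Finite)
    -- regular: for each `i`, all `i`-panels have the same cardinality
    (hreg : ∀ (i : B) (C D : Δ),
      {D' : Δ | δ C D' = 1 ∨ δ C D' = cs.simple i}.ncard =
        {D' : Δ | δ D D' = 1 ∨ δ D D' = cs.simple i}.ncard)
    (i : B)
    -- (a) every `i`-panel has at least 3 chambers
    (hthick : ∀ C : Δ, 3 ≤ {D : Δ | δ C D = 1 ∨ δ C D = cs.simple i}.ncard)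
    -- (b) `sᵢ` is not contained in a finite direct factor of `W`
    (hfactor : ¬ ∃ J : Finset B, i ∈ J ∧
      (∀ j ∈ J, ∀ j' ∈ J, j ≠ j' → M j j' = 2) ∧
      (∀ j ∈ J, ∀ k : B, k ∉ J → M j k = 2)) :
    Uncountable {G : Δ ≃ Δ // ∀ C D : Δ, δ (G C) (G D) = δ C D} := by
  classical
  have b : RAB.Bldg cs δ := ⟨hWD1, hWD2, hWD3, hra⟩
  obtain ⟨k, hik, h0⟩ : ∃ k, i ≠ k ∧ M i k = 0 := by
    by_contra hcon
    push Not at hcon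
    apply hfactor
    refine ⟨{i}, by simp, ?_, ?_⟩
    · intro j hj j' hj' hne
      simp only [Finset.mem_singleton] at hj hj'
      exact absurd (hj.trans hj'.symm) hne
    · intro j hj l hl
      simp only [Finset.mem_singleton] at hj hl
      subst hj
      exact (hra j l (Ne.symm hl)).resolve_right (hcon l (Ne.symm hl))
  have h0' : M k i = 0 := by rw [M.symmetric]; exact h0
  obtain ⟨c⟩ := ‹Nonempty Δ›
  let q : B → ℕ := fun j => {D : Δ | RAB.Adj cs δ j c D}.ncard
  have hq : ∀ j C, {D : Δ | RAB.Adj cs δ j C D}.ncard = q j := fun j C => hreg j C c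
  have hfin' : ∀ j C, {D : Δ | RAB.Adj cs δ j C D}.Finite := fun j C => hfin j C
  have hq3 : 3 ≤ q i := hthick c
  have hqne : ∀ j, Nonempty (Fin (q j)) := by
    intro j
    have : 0 < q j := (Set.ncard_pos (hfin' j c)).2 ⟨c, RAB.adj_refl b j c⟩
    exact ⟨⟨0, this⟩⟩
  have hbase : ∀ j, ∃ h : Δ → Fin (q j), RAB.Legal cs δ j h := by
    intro j
    have : ∀ (g : Δ) (y : Fin (q j)), ∃ e : Δ → Fin (q j), e g = y ∧
        Set.InjOn e {D : Δ | RAB.Adj cs δ j g D} := fun g y =>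
      RAB.exists_E _ (hfin' j g) (hq j g) g (RAB.adj_refl b j g) y
    choose E hE1 hE2 using this
    obtain ⟨h, hh, _⟩ := RAB.exists_legal b c j (hfin' j)
      (fun C => by rw [hq, Nat.card_fin]) E hE1 hE2
    exact ⟨h, hh⟩
  choose h' hl' using hbase
  rw [← not_countable_iff]
  intro hcount
  have hne : Nonempty {G : Δ ≃ Δ // ∀ C D : Δ, δ (G C) (G D) = δ C D} :=
    ⟨⟨Equiv.refl _, fun _ _ => rfl⟩⟩
  obtain ⟨φ, hφ⟩ := exists_surjective_nat {G : Δ ≃ Δ // ∀ C D : Δ, δ (G C) (G D) = δ C D}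
  -- the distinguished chambers
  have hx : ∀ n : ℕ, ∃ x, δ x c = RAB.alt cs i k (n + 1) := fun n => RAB.exists_weight b c _
  choose x hx using hx
  have hxd : ∀ n, cs.IsLeftDescent (δ (x n) c) i := by
    intro n
    rw [hx, RAB.alt, RAB.desc_smul]
    exact RAB.alt_desc_ne cs hra hik.symm h0' n
  have hxd' : ∀ n l, cs.IsLeftDescent (δ (x n) c) l → l = i := by
    intro n l hl
    rw [hx] at hl
    exact RAB.alt_desc cs hra hik h0 _ l hl
  let g : ℕ → Δ := fun n => RAB.gate b c i (x n)
  have hgw : ∀ n, cs.length (δ (g n) c) = n := by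
    intro n
    simp only [g]
    rw [RAB.gate_w b, hx, RAB.alt, cs.simple_mul_simple_cancel_left]
    exact (RAB.alt_length cs hra hik h0 n).2
  have hginj : ∀ n m, g n = g m → n = m := by
    intro n m h
    rw [← hgw n, h, hgw]
  have hgx : ∀ n, RAB.Adj cs δ i (g n) (x n) := fun n => RAB.gate_adj b c i (x n)
  have hgne : ∀ n, x n ≠ g n := by
    intro n h
    have h1 := hgw n
    have h2 := (RAB.alt_length cs hra hik h0 (n + 1)).1
    rw [← hx, h, h1] at h2
    omega
  have hEi : ∀ (u : Δ) (y : Fin (q i)), ∃ e : Δ → Fin (q i), e u = y ∧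
      Set.InjOn e {D : Δ | RAB.Adj cs δ i u D} ∧
      ∀ n, u = g n → e (x n) ≠ h' i ((φ n).1 (x n)) := by
    intro u y
    by_cases hu : ∃ n, u = g n
    · obtain ⟨n, rfl⟩ := hu
      obtain ⟨e, e1, e2, e3⟩ := RAB.exists_E' _ (hfin' i (g n)) (hq i (g n)) hq3 (g n)
        (RAB.adj_refl b i (g n)) y (x n) (hgx n) (hgne n) (h' i ((φ n).1 (x n)))
      refine ⟨e, e1, e2, ?_⟩
      intro m hm
      rw [← hginj n m hm]
      exact e3
    · obtain ⟨e, e1, e2⟩ := RAB.exists_E _ (hfin' i u) (hq i u) u (RAB.adj_refl b i u) y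
      exact ⟨e, e1, e2, fun n hn => absurd ⟨n, hn⟩ hu⟩
  choose E hE1 hE2 hE3 using hEi
  obtain ⟨hi, hil, hi2⟩ := RAB.exists_legal b c i (hfin' i)
    (fun C => by rw [hq, Nat.card_fin]) E hE1 hE2
  let h : ∀ j, Δ → Fin (q j) := Function.update h' i hi
  have hhi : h i = hi := Function.update_self ..
  have hhj : ∀ j, j ≠ i → h j = h' j := fun j hj => Function.update_of_ne hj ..
  have hl : ∀ j, RAB.Legal cs δ j (h j) := by
    intro j
    by_cases hj : j = i
    · subst hj; rw [hhi]; exact hil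
    · rw [hhj j hj]; exact hl' j
  have hc' : ∃ c', ∀ j, h' j c' = h j c := by
    obtain ⟨c', hc1, hc2⟩ := (hl' i).surj c (hi c)
    refine ⟨c', fun j => ?_⟩
    by_cases hj : j = i
    · subst hj; rw [hhi]; exact hc2
    · rw [hhj j hj]; exact ((hl' j).const i (Ne.symm hj) _ _ hc1).symm
  obtain ⟨f, hf1, hf2⟩ := RAB.exists_aut b c h h' hl hl' hc'
  obtain ⟨n, hn⟩ := hφ ⟨f, hf1⟩
  have e1 := hE3 (g n) (hi (g n)) n rfl
  rw [← hi2 (x n) (hxd n) (hxd' n), hn] at e1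
  apply e1
  rw [hf2, hhi]
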